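/- For all x > 0 and 0 < a < b, the principal value integral over t in (0, ∞) of sin(a t) / (sin(b t) · (x² + t²)) dt equals (π/2) · sinh(a x) / (x · sinh(b x)). -/

import Mathlib

open Real MeasureTheory Filter intervalIntegral

/-- `IsPVIntegral f p L` means the principal value of `∫₀^∞ f`, where `f` has
simple poles at the increasing sequence `p k`, equals `L`: for each sufficiently
small `ε > 0` one sums the integrals over the pole-free gaps (each pole shielded
by an `ε`-neighborhood), takes the limit over the number `N` of gaps, and this
value tends to `L` as `ε → 0⁺`. -/
def IsPVIntegral (f : ℝ → ℝ) (p : ℕ → ℝ) (L : ℝ) : Prop :=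
  ∃ ε₀ > (0:ℝ), ∃ F : ℝ → ℝ,
    (∀ ε ∈ Set.Ioo (0:ℝ) ε₀,
      Filter.Tendsto (fun N : ℕ =>
          (∫ t in (0:ℝ)..(p 0 - ε), f t) +
            ∑ k ∈ Finset.range N, ∫ t in (p k + ε)..(p (k + 1) - ε), f t)
        Filter.atTop (nhds (F ε))) ∧
    Filter.Tendsto F (nhdsWithin 0 (Set.Ioi 0)) (nhds L)

open scoped FourierTransform

theorem integrable_inv_sq_add_sq {x : ℝ} (hx : 0 < x) :
    Integrable (fun t : ℝ => (x ^ 2 + t ^ 2)⁻¹) := by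
  have h := (integrable_inv_one_add_sq.comp_div hx.ne').const_mul (x ^ 2)⁻¹
  refine h.congr (ae_of_all _ fun t => ?_)
  have := sq_nonneg t
  simp only
  field_simp

theorem integrable_exp_neg_mul_abs {c : ℝ} (hc : 0 < c) :
    Integrable (fun v : ℝ => Complex.exp (-(c * |v| : ℝ))) := by
  rw [← integrableOn_univ, ← Set.Iic_union_Ioi (a := (0 : ℝ))]
  refine IntegrableOn.union ?_ ?_
  · refine (integrableOn_exp_mul_complex_Iic (a := c) (by simpa) 0).congr_fun ?_ measurableSet_Iic
    intro v hv
    simp [abs_of_nonpos (show v ≤ 0 from hv)]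
  · refine (integrableOn_exp_mul_complex_Ioi (a := -c) (by simpa) 0).congr_fun ?_ measurableSet_Ioi
    intro v hv
    simp [abs_of_pos (show 0 < v from hv)]

theorem fourier_exp_neg_mul_abs {x : ℝ} (hx : 0 < x) (w : ℝ) :
    𝓕 (fun v : ℝ => Complex.exp (-(2 * π * x * |v| : ℝ))) w =
      (x / π : ℂ) * ((x ^ 2 + w ^ 2)⁻¹ : ℝ) := by
  have hpi := Real.pi_pos
  have hre₁ : 0 < (2 * π * (x - w * Complex.I) : ℂ).re := by simp; positivity
  have hre₂ : (-(2 * π * (x + w * Complex.I)) : ℂ).re < 0 := by simp; positivity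
  have e₁ : Set.EqOn (fun v : ℝ => Complex.exp (2 * π * (x - w * Complex.I) * v))
      (fun v : ℝ => Complex.exp (↑(-2 * π * v * w) * Complex.I) •
        Complex.exp (-(2 * π * x * |v| : ℝ))) (Set.Iic 0) := by
    intro v hv
    simp only [smul_eq_mul, ← Complex.exp_add, abs_of_nonpos (show v ≤ 0 from hv)]
    congr 1; push_cast; ring
  have e₂ : Set.EqOn (fun v : ℝ => Complex.exp (-(2 * π * (x + w * Complex.I)) * v))
      (fun v : ℝ => Complex.exp (↑(-2 * π * v * w) * Complex.I) •
        Complex.exp (-(2 * π * x * |v| : ℝ))) (Set.Ioi 0) := by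
    intro v hv
    simp only [smul_eq_mul, ← Complex.exp_add, abs_of_pos (show 0 < v from hv)]
    congr 1; push_cast; ring
  have i₁ := (integrableOn_exp_mul_complex_Iic hre₁ 0).congr_fun e₁ measurableSet_Iic
  have i₂ := (integrableOn_exp_mul_complex_Ioi hre₂ 0).congr_fun e₂ measurableSet_Ioi
  rw [Real.fourier_real_eq_integral_exp_smul, ← setIntegral_univ,
    ← Set.Iic_union_Ioi (a := (0 : ℝ)),
    setIntegral_union (Set.Iic_disjoint_Ioi le_rfl) measurableSet_Ioi i₁ i₂,
    ← setIntegral_congr_fun measurableSet_Iic e₁, ← setIntegral_congr_fun measurableSet_Ioi e₂,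
    integral_exp_mul_complex_Iic hre₁, integral_exp_mul_complex_Ioi hre₂]
  have h₁ : (x - w * Complex.I : ℂ) ≠ 0 := fun h => by
    have := congrArg Complex.re h; simp at this; exact hx.ne' this
  have h₂ : (x + w * Complex.I : ℂ) ≠ 0 := fun h => by
    have := congrArg Complex.re h; simp at this; exact hx.ne' this
  have h₃ : (x ^ 2 + w ^ 2 : ℂ) = (x - w * Complex.I) * (x + w * Complex.I) := by
    ring_nf; simp
  have hpc : (π : ℂ) ≠ 0 := by exact_mod_cast hpi.ne'
  push_cast
  rw [h₃]
  field_simp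
  simp
  ring

theorem integral_cos_mul_inv_sq_add_sq {x : ℝ} (hx : 0 < x) {c : ℝ} (hc : 0 ≤ c) :
    ∫ t in Set.Ioi (0 : ℝ), Real.cos (c * t) * (x ^ 2 + t ^ 2)⁻¹ =
      π / (2 * x) * Real.exp (-(c * x)) := by
  have hpi := Real.pi_pos
  have hF := funext (fourier_exp_neg_mul_abs hx)
  have hint : Integrable (𝓕 (fun v : ℝ => Complex.exp (-(2 * π * x * |v| : ℝ)))) := by
    rw [hF]
    exact ((integrable_inv_sq_add_sq hx).ofReal).const_mul _
  have hinv := congrFun (Continuous.fourierInv_fourier_eq (by fun_prop)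
    (integrable_exp_neg_mul_abs (c := 2 * π * x) (by positivity)) hint) (c / (2 * π))
  rw [hF, Real.fourierInv_eq'] at hinv
  have hint' : Integrable (fun v : ℝ => Complex.exp (↑(2 * π * inner ℝ v (c / (2 * π))) * Complex.I)
      • ((x / π : ℂ) * ((x ^ 2 + v ^ 2)⁻¹ : ℝ))) := by
    rw [hF] at hint
    refine (hint.bdd_mul (c := 1) ?_ ?_)
    · exact Continuous.aestronglyMeasurable (by fun_prop)
    · exact ae_of_all _ fun v => (Complex.norm_exp_ofReal_mul_I _).le
  have hre := congrArg Complex.re hinv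
  rw [← RCLike.re_to_complex, ← integral_re hint'] at hre
  have hpt : ∀ v : ℝ, RCLike.re (Complex.exp (↑(2 * π * inner ℝ v (c / (2 * π))) * Complex.I)
      • ((x / π : ℂ) * ((x ^ 2 + v ^ 2)⁻¹ : ℝ))) =
      (x / π) * (Real.cos (c * |v|) * (x ^ 2 + |v| ^ 2)⁻¹) := by
    intro v
    have h1 : 2 * π * inner ℝ v (c / (2 * π)) = c * v := by
      simp; field_simp
    have h2 : Real.cos (c * |v|) = Real.cos (c * v) := by
      rw [← Real.cos_abs (c * v), abs_mul, abs_of_nonneg hc]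
    rw [h1, h2, sq_abs, RCLike.re_to_complex, smul_eq_mul, ← mul_assoc, mul_comm,
      Complex.re_ofReal_mul, ← Complex.ofReal_div, Complex.re_mul_ofReal,
      Complex.exp_ofReal_mul_I_re]
    ring
  simp_rw [hpt] at hre
  rw [MeasureTheory.integral_const_mul,
    integral_comp_abs (f := fun t => Real.cos (c * t) * (x ^ 2 + t ^ 2)⁻¹)] at hre
  have hr : (Complex.exp (-(2 * π * x * |c / (2 * π)| : ℝ))).re = Real.exp (-(c * x)) := by
    rw [← Complex.ofReal_neg, Complex.exp_ofReal_re,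
      abs_of_nonneg (by positivity)]
    congr 1; field_simp
  rw [hr] at hre
  rw [← hre]
  field_simp

/-- The integrand `sin (a t) / (sin (b t) (x² + t²))`. -/
noncomputable def sinQuotient (a b x t : ℝ) : ℝ :=
  Real.sin (a * t) / (Real.sin (b * t) * (x ^ 2 + t ^ 2))

/-- The positive poles of `sinQuotient a b x`. -/
noncomputable def sinPole (b : ℝ) (k : ℕ) : ℝ := ((k : ℝ) + 1) * Real.pi / b

/-- The sum of the values of `sinQuotient` at two points symmetric about a pole. -/
noncomputable def sinQuotientFold (a b x : ℝ) (k : ℕ) (s : ℝ) : ℝ :=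
  sinQuotient a b x (sinPole b k + s) + sinQuotient a b x (sinPole b k - s)

@[fun_prop]
theorem measurable_sinQuotient (a b x : ℝ) : Measurable (sinQuotient a b x) := by
  unfold sinQuotient; fun_prop

@[fun_prop]
theorem measurable_sinQuotientFold (a b x : ℝ) (k : ℕ) : Measurable (sinQuotientFold a b x k) := by
  unfold sinQuotientFold; fun_prop

theorem intervalIntegrable_of_measurable_of_bounded {φ : ℝ → ℝ} (hm : Measurable φ) {c d C : ℝ}
    (hcd : c ≤ d) (hb : ∀ s ∈ Set.Ioc c d, |φ s| ≤ C) : IntervalIntegrable φ volume c d := by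
  rw [intervalIntegrable_iff_integrableOn_Ioc_of_le hcd]
  refine Measure.integrableOn_of_bounded (M := C) (by simp) hm.aestronglyMeasurable ?_
  exact (ae_restrict_iff' measurableSet_Ioc).2 (ae_of_all _ hb)

theorem sin_mul_sinPole_add {b : ℝ} (hb : 0 < b) (k : ℕ) (s : ℝ) :
    Real.sin (b * (sinPole b k + s)) = (-1) ^ (k + 1) * Real.sin (b * s) := by
  have : b * (sinPole b k + s) = b * s + ((k + 1 : ℕ) : ℝ) * π := by
    unfold sinPole; push_cast; field_simp; ring
  rw [this, Real.sin_add_nat_mul_pi]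

theorem sin_mul_sinPole_sub {b : ℝ} (hb : 0 < b) (k : ℕ) (s : ℝ) :
    Real.sin (b * (sinPole b k - s)) = -((-1) ^ (k + 1) * Real.sin (b * s)) := by
  have := sin_mul_sinPole_add hb k (-s)
  simpa [sub_eq_add_neg] using this

theorem cos_mul_sinPole_add {b : ℝ} (hb : 0 < b) (M k : ℕ) (s : ℝ) :
    Real.cos (2 * M * (b * (sinPole b k + s))) = Real.cos (2 * M * (b * s)) := by
  have : 2 * M * (b * (sinPole b k + s)) =
      2 * M * (b * s) + ((M * (k + 1) : ℕ) : ℝ) * (2 * π) := by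
    unfold sinPole; push_cast; field_simp; ring
  rw [this, Real.cos_add_nat_mul_two_pi]

theorem cos_mul_sinPole_sub {b : ℝ} (hb : 0 < b) (M k : ℕ) (s : ℝ) :
    Real.cos (2 * M * (b * (sinPole b k - s))) = Real.cos (2 * M * (b * s)) := by
  have := cos_mul_sinPole_add hb M k (-s)
  simpa [sub_eq_add_neg] using this

theorem two_div_pi_mul_le_sin_mul {b s : ℝ} (hb : 0 < b) (hs : s ∈ Set.Ioc 0 (π / (2 * b))) :
    2 / π * (b * s) ≤ Real.sin (b * s) := by
  refine Real.mul_le_sin (mul_nonneg hb.le hs.1.le) ?_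
  have := mul_le_mul_of_nonneg_left hs.2 hb.le
  calc b * s ≤ _ := this
    _ = π / 2 := by field_simp

theorem sin_mul_pos {b s : ℝ} (hb : 0 < b) (hs : s ∈ Set.Ioc 0 (π / (2 * b))) :
    0 < Real.sin (b * s) :=
  lt_of_lt_of_le (by have := hs.1; positivity) (two_div_pi_mul_le_sin_mul hb hs)

theorem abs_sinQuotient_le {a b x : ℝ} (ha : 0 < a) (hb : 0 < b) (hx : 0 < x) {s : ℝ}
    (hs : s ∈ Set.Ioc 0 (π / (2 * b))) :
    |sinQuotient a b x s| ≤ a * π / (2 * b * x ^ 2) := by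
  have hs0 := hs.1
  have h1 := two_div_pi_mul_le_sin_mul hb hs
  have h2 : |Real.sin (a * s)| ≤ a * s :=
    Real.abs_sin_le_abs.trans_eq (abs_of_pos (by positivity))
  have h3 := sin_mul_pos hb hs
  rw [sinQuotient, abs_div, abs_of_pos (a := _ * (x ^ 2 + s ^ 2)) (by positivity)]
  calc |Real.sin (a * s)| / (Real.sin (b * s) * (x ^ 2 + s ^ 2))
      ≤ a * s / (2 / π * (b * s) * x ^ 2) := by
        gcongr
        nlinarith [sq_nonneg s]
    _ = _ := by field_simp

theorem half_period_mul_le_sinPole_sub {b : ℝ} (hb : 0 < b) (k : ℕ) :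
    π / (2 * b) * (k + 1) ≤ sinPole b k - π / (2 * b) := by
  have : 0 ≤ π / (2 * b) * k := by positivity
  have h2 : sinPole b k - π / (2 * b) = π / (2 * b) * (k + 1) + π / (2 * b) * k := by
    unfold sinPole; field_simp; ring
  linarith

theorem abs_sinQuotient_le_of_abs_sin {a b x t δ m : ℝ} (hm : 0 < m) (hδ : 0 < δ) (hmt : m ≤ t)
    (hs : δ ≤ |Real.sin (b * t)|) : |sinQuotient a b x t| ≤ 1 / (δ * m ^ 2) := by
  rw [sinQuotient, abs_div, abs_mul, abs_of_nonneg (a := x ^ 2 + t ^ 2) (by positivity)]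
  have : m ^ 2 ≤ x ^ 2 + t ^ 2 := by nlinarith [sq_nonneg x]
  gcongr
  exact Real.abs_sin_le_one _

theorem abs_sinQuotient_sinPole_add_le {a b x : ℝ} (hb : 0 < b) (k : ℕ) {ε s : ℝ}
    (hε : 0 < ε) (hs : s ∈ Set.Icc ε (π / (2 * b))) :
    |sinQuotient a b x (sinPole b k + s)| ≤
      1 / (2 / π * (b * ε) * (π / (2 * b) * (k + 1)) ^ 2) := by
  have hpi := Real.pi_pos
  have hs' : s ∈ Set.Ioc 0 (π / (2 * b)) := ⟨hε.trans_le hs.1, hs.2⟩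
  have h1 := half_period_mul_le_sinPole_sub hb k
  have hh : 0 < π / (2 * b) := by positivity
  refine abs_sinQuotient_le_of_abs_sin (by positivity) (by positivity) (by linarith [hs'.1]) ?_
  rw [sin_mul_sinPole_add hb, abs_mul, abs_pow, abs_neg, abs_one, one_pow, one_mul]
  refine le_trans ?_ ((two_div_pi_mul_le_sin_mul hb hs').trans (le_abs_self _))
  have := hs.1
  gcongr

theorem abs_sinQuotient_sinPole_sub_le {a b x : ℝ} (hb : 0 < b) (k : ℕ) {ε s : ℝ}
    (hε : 0 < ε) (hs : s ∈ Set.Icc ε (π / (2 * b))) :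
    |sinQuotient a b x (sinPole b k - s)| ≤
      1 / (2 / π * (b * ε) * (π / (2 * b) * (k + 1)) ^ 2) := by
  have hpi := Real.pi_pos
  have hs' : s ∈ Set.Ioc 0 (π / (2 * b)) := ⟨hε.trans_le hs.1, hs.2⟩
  have h1 := half_period_mul_le_sinPole_sub hb k
  refine abs_sinQuotient_le_of_abs_sin (by positivity) (by positivity) (by linarith [hs'.2]) ?_
  rw [sin_mul_sinPole_sub hb, abs_neg, abs_mul, abs_pow, abs_neg, abs_one, one_pow, one_mul]
  refine le_trans ?_ ((two_div_pi_mul_le_sin_mul hb hs').trans (le_abs_self _))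
  have := hs.1
  gcongr

theorem abs_sin_div_sq_add_sq_sub_le {a x m u v : ℝ} (ha : 0 < a) (hx : 0 < x) (hm : 0 < m)
    (hu : m ≤ u) (hv : m ≤ v) :
    |Real.sin (a * u) / (x ^ 2 + u ^ 2) - Real.sin (a * v) / (x ^ 2 + v ^ 2)| ≤
      (a + 1 / x) / m ^ 2 * |u - v| := by
  have hder : ∀ t ∈ Set.Ici m, HasDerivWithinAt (fun t => Real.sin (a * t) / (x ^ 2 + t ^ 2))
      ((Real.cos (a * t) * a * (x ^ 2 + t ^ 2) - Real.sin (a * t) * (2 * t)) /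
        (x ^ 2 + t ^ 2) ^ 2) (Set.Ici m) t := by
    intro t ht
    have h1 : HasDerivAt (fun t => Real.sin (a * t)) (Real.cos (a * t) * a) t := by
      simpa using ((hasDerivAt_id t).const_mul a).sin
    have h2 : HasDerivAt (fun t => x ^ 2 + t ^ 2) (2 * t) t := by
      simpa using (hasDerivAt_pow 2 t).const_add (x ^ 2)
    exact (h1.div h2 (by positivity)).hasDerivWithinAt
  refine Convex.norm_image_sub_le_of_norm_hasDerivWithin_le hder ?_ (convex_Ici m) hv hu
  intro t ht
  have ht0 : 0 < t := hm.trans_le ht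
  have hmt : m ≤ t := ht
  set d := x ^ 2 + t ^ 2 with hd
  have hdpos : 0 < d := by positivity
  have hmd : m ^ 2 ≤ d := by nlinarith [sq_nonneg x]
  have htx : 2 * t ≤ 1 / x * d := by
    rw [hd, one_div, inv_mul_eq_div, le_div_iff₀ hx]; nlinarith [sq_nonneg (x - t)]
  have hnum : |Real.cos (a * t) * a * d - Real.sin (a * t) * (2 * t)| ≤ (a + 1 / x) * d := by
    have e1 : |Real.cos (a * t) * a * d| ≤ a * d := by
      rw [mul_assoc, abs_mul, abs_of_pos (a := a * d) (by positivity)]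
      exact mul_le_of_le_one_left (by positivity) (Real.abs_cos_le_one _)
    have e2 : |Real.sin (a * t) * (2 * t)| ≤ 2 * t := by
      rw [abs_mul, abs_of_pos (a := 2 * t) (by positivity)]
      exact mul_le_of_le_one_left (by positivity) (Real.abs_sin_le_one _)
    calc _ ≤ _ := abs_sub _ _
      _ ≤ a * d + 1 / x * d := by gcongr; exact e2.trans htx
      _ = _ := by ring
  rw [Real.norm_eq_abs, abs_div, abs_of_pos (a := d ^ 2) (by positivity)]
  calc _ ≤ (a + 1 / x) * d / d ^ 2 := by gcongr
    _ = (a + 1 / x) / d := by field_simp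
    _ ≤ _ := by gcongr

theorem sinQuotientFold_eq {a b x : ℝ} (hb : 0 < b) (k : ℕ) (s : ℝ) :
    sinQuotientFold a b x k s = (-1) ^ (k + 1) *
      (Real.sin (a * (sinPole b k + s)) / (x ^ 2 + (sinPole b k + s) ^ 2) -
        Real.sin (a * (sinPole b k - s)) / (x ^ 2 + (sinPole b k - s) ^ 2)) /
          Real.sin (b * s) := by
  unfold sinQuotientFold sinQuotient
  rw [sin_mul_sinPole_add hb, sin_mul_sinPole_sub hb]
  rcases neg_one_pow_eq_or ℝ (k + 1) with h | h <;> rw [h] <;>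
    simp only [neg_mul, one_mul, neg_neg, div_neg, mul_comm (Real.sin (b * s)), ← div_div] <;> ring

/-- A summable bound for `sinQuotientFold a b x`. -/
noncomputable def foldBound (a b x : ℝ) (k : ℕ) : ℝ :=
  (a + 1 / x) * π / b * (π / (2 * b)) ^ (-2 : ℤ) * (1 / ((k + 1 : ℕ) : ℝ) ^ 2)

theorem summable_foldBound (a b x : ℝ) : Summable (foldBound a b x) :=
  ((summable_nat_add_iff 1).2 (Real.summable_one_div_nat_pow.2 one_lt_two)).mul_left _

theorem abs_sinQuotientFold_le {a b x : ℝ} (ha : 0 < a) (hb : 0 < b) (hx : 0 < x) (k : ℕ) {s : ℝ}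
    (hs : s ∈ Set.Ioc 0 (π / (2 * b))) :
    |sinQuotientFold a b x k s| ≤ foldBound a b x k := by
  have hs0 := hs.1
  have hsin := sin_mul_pos hb hs
  have hm := half_period_mul_le_sinPole_sub hb k
  have hmain := abs_sin_div_sq_add_sq_sub_le (m := π / (2 * b) * (k + 1)) ha hx (by positivity)
    (u := sinPole b k + s) (v := sinPole b k - s) (by linarith [hs.2]) (by linarith [hs.2])
  have huv : |sinPole b k + s - (sinPole b k - s)| = 2 * s := by
    rw [show sinPole b k + s - (sinPole b k - s) = 2 * s by ring, abs_of_pos (by positivity)]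
  rw [huv] at hmain
  rw [sinQuotientFold_eq hb, abs_div, abs_mul, abs_pow, abs_neg, abs_one, one_pow, one_mul,
    abs_of_pos hsin]
  calc _ ≤ (a + 1 / x) / (π / (2 * b) * (k + 1)) ^ 2 * (2 * s) / (2 / π * (b * s)) := by
        gcongr
        exact two_div_pi_mul_le_sin_mul hb hs
    _ = foldBound a b x k := by
        unfold foldBound
        rw [zpow_neg, zpow_ofNat]
        push_cast
        field_simp

theorem sinPole_eq (b : ℝ) (k : ℕ) : sinPole b k = 2 * (k + 1) * (π / (2 * b)) := by
  unfold sinPole; ring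

theorem intervalIntegrable_sinQuotient {a b x : ℝ} (ha : 0 < a) (hb : 0 < b) (hx : 0 < x) :
    IntervalIntegrable (sinQuotient a b x) volume 0 (π / (2 * b)) :=
  intervalIntegrable_of_measurable_of_bounded (by fun_prop) (by positivity)
    fun _ hs => abs_sinQuotient_le ha hb hx hs

theorem intervalIntegrable_sinQuotientFold {a b x : ℝ} (ha : 0 < a) (hb : 0 < b) (hx : 0 < x)
    (k : ℕ) : IntervalIntegrable (sinQuotientFold a b x k) volume 0 (π / (2 * b)) :=
  intervalIntegrable_of_measurable_of_bounded (by fun_prop) (by positivity)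
    fun _ hs => abs_sinQuotientFold_le ha hb hx k hs

theorem intervalIntegrable_sinQuotient_sinPole_add {a b x ε : ℝ} (hb : 0 < b)
    (hε : ε ∈ Set.Ioo 0 (π / (2 * b))) (k : ℕ) :
    IntervalIntegrable (fun s => sinQuotient a b x (sinPole b k + s)) volume ε (π / (2 * b)) :=
  intervalIntegrable_of_measurable_of_bounded (by fun_prop) hε.2.le
    fun _ hs => abs_sinQuotient_sinPole_add_le hb k hε.1 ⟨hs.1.le, hs.2⟩

theorem intervalIntegrable_sinQuotient_sinPole_sub {a b x ε : ℝ} (hb : 0 < b)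
    (hε : ε ∈ Set.Ioo 0 (π / (2 * b))) (k : ℕ) :
    IntervalIntegrable (fun s => sinQuotient a b x (sinPole b k - s)) volume ε (π / (2 * b)) :=
  intervalIntegrable_of_measurable_of_bounded (by fun_prop) hε.2.le
    fun _ hs => abs_sinQuotient_sinPole_sub_le hb k hε.1 ⟨hs.1.le, hs.2⟩

theorem integral_gap_sum_eq_fold {a b x ε : ℝ} (ha : 0 < a) (hb : 0 < b) (hx : 0 < x)
    (hε : ε ∈ Set.Ioo 0 (π / (2 * b))) (N : ℕ) :
    (∫ t in (0 : ℝ)..(sinPole b 0 - ε), sinQuotient a b x t) +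
        ∑ k ∈ Finset.range N,
          ∫ t in (sinPole b k + ε)..(sinPole b (k + 1) - ε), sinQuotient a b x t =
      (∫ t in (0 : ℝ)..(π / (2 * b)), sinQuotient a b x t) +
        (∑ k ∈ Finset.range N, ∫ s in ε..(π / (2 * b)), sinQuotientFold a b x k s) +
        ∫ s in ε..(π / (2 * b)), sinQuotient a b x (sinPole b N - s) := by
  have iadd (k : ℕ) : IntervalIntegrable (sinQuotient a b x) volume (sinPole b k + ε)
      (sinPole b k + π / (2 * b)) := by
    simpa [add_comm] using (intervalIntegrable_sinQuotient_sinPole_add (a := a) (x := x) hb hε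
      k).comp_sub_right (sinPole b k)
  have isub (k : ℕ) : IntervalIntegrable (sinQuotient a b x) volume (sinPole b k - π / (2 * b))
      (sinPole b k - ε) := by
    simpa using ((intervalIntegrable_sinQuotient_sinPole_sub (a := a) (x := x) hb hε
      k).comp_sub_left (sinPole b k)).symm
  have hmid (k : ℕ) : sinPole b k + π / (2 * b) = sinPole b (k + 1) - π / (2 * b) := by
    rw [sinPole_eq, sinPole_eq]; push_cast; ring
  have hmid₀ : sinPole b 0 - π / (2 * b) = π / (2 * b) := by
    rw [sinPole_eq]; push_cast; ring
  induction N with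
  | zero =>
    have h0 := isub 0
    rw [hmid₀] at h0
    simp only [Finset.range_zero, Finset.sum_empty, add_zero]
    rw [intervalIntegral.integral_comp_sub_left (sinQuotient a b x), hmid₀,
      integral_add_adjacent_intervals (intervalIntegrable_sinQuotient ha hb hx) h0]
  | succ N ih =>
    have hfold : ∫ s in ε..(π / (2 * b)), sinQuotientFold a b x N s =
        (∫ s in ε..(π / (2 * b)), sinQuotient a b x (sinPole b N + s)) +
        ∫ s in ε..(π / (2 * b)), sinQuotient a b x (sinPole b N - s) :=
      integral_add (intervalIntegrable_sinQuotient_sinPole_add hb hε N)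
        (intervalIntegrable_sinQuotient_sinPole_sub hb hε N)
    have hgap : ∫ t in (sinPole b N + ε)..(sinPole b (N + 1) - ε), sinQuotient a b x t =
        (∫ s in ε..(π / (2 * b)), sinQuotient a b x (sinPole b N + s)) +
        ∫ s in ε..(π / (2 * b)), sinQuotient a b x (sinPole b (N + 1) - s) := by
      rw [intervalIntegral.integral_comp_sub_left (sinQuotient a b x),
        intervalIntegral.integral_comp_add_left (sinQuotient a b x), ← hmid,
        integral_add_adjacent_intervals (iadd N) (hmid N ▸ isub (N + 1))]
    rw [Finset.sum_range_succ, Finset.sum_range_succ, ← add_assoc, ih, hfold, hgap]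
    ring

theorem integral_fold_eq {Φ : ℝ → ℝ} (hΦ : Continuous Φ) (b : ℝ) (N : ℕ) :
    (∫ t in (0 : ℝ)..(π / (2 * b)), Φ t) + ∑ k ∈ Finset.range N,
        ∫ s in (0 : ℝ)..(π / (2 * b)), (Φ (sinPole b k + s) + Φ (sinPole b k - s)) =
      ∫ t in (0 : ℝ)..((2 * N + 1) * (π / (2 * b))), Φ t := by
  have hi (c d : ℝ) : IntervalIntegrable Φ volume c d := hΦ.intervalIntegrable c d
  induction N with
  | zero => simp
  | succ N ih =>
    rw [Finset.sum_range_succ, ← add_assoc, ih, integral_add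
      (Continuous.intervalIntegrable (by fun_prop) _ _)
      (Continuous.intervalIntegrable (by fun_prop) _ _),
      intervalIntegral.integral_comp_sub_left Φ, intervalIntegral.integral_comp_add_left Φ,
      add_comm (∫ t in (sinPole b N + 0).._, Φ t), sub_zero, add_zero,
      integral_add_adjacent_intervals (hi _ _) (hi _ _)]
    have e₁ : sinPole b N - π / (2 * b) = (2 * N + 1) * (π / (2 * b)) := by
      rw [sinPole_eq]; ring
    have e₂ : sinPole b N + π / (2 * b) = (2 * (N + 1 : ℕ) + 1) * (π / (2 * b)) := by
      rw [sinPole_eq]; push_cast; ring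
    rw [e₁, e₂, integral_add_adjacent_intervals (hi _ _) (hi _ _)]

theorem tendsto_integral_mul_cos {b h : ℝ} (hb : 0 < b) (hh : 0 ≤ h) {φ : ℝ → ℝ}
    (hφ : IntervalIntegrable φ volume 0 h) :
    Tendsto (fun M : ℕ => ∫ s in (0 : ℝ)..h, φ s * Real.cos (2 * M * (b * s))) atTop
      (nhds 0) := by
  have hpi := Real.pi_pos
  have hint : IntegrableOn φ (Set.Ioc 0 h) :=
    (intervalIntegrable_iff_integrableOn_Ioc_of_le hh).1 hφ
  set ψ : ℝ → ℂ := (Set.Ioc 0 h).indicator fun s => (φ s : ℂ) with hψ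
  have hψi : Integrable ψ := (integrable_indicator_iff measurableSet_Ioc).2 hint.ofReal
  have hlim : Tendsto (fun M : ℕ => b / π * (M : ℝ)) atTop (cocompact ℝ) :=
    (tendsto_natCast_atTop_atTop.const_mul_atTop (by positivity)).mono_right
      atTop_le_cocompact
  have hre := (Complex.continuous_re.tendsto 0).comp
    ((Real.tendsto_integral_exp_smul_cocompact ψ).comp hlim)
  rw [Complex.zero_re] at hre
  refine hre.congr fun M => ?_
  have hi : Integrable fun v : ℝ => Real.fourierChar (-(v * (b / π * M))) • ψ v := by
    simpa [mul_comm] using (Real.fourierIntegral_convergent_iff (f := ψ) (μ := volume) (b / π * M : ℝ)).2 hψi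
  simp only [Function.comp_apply]
  rw [← RCLike.re_to_complex, ← integral_re hi, intervalIntegral.integral_of_le hh,
    ← MeasureTheory.integral_indicator measurableSet_Ioc]
  congr 1
  ext v
  by_cases hv : v ∈ Set.Ioc 0 h
  · have harg : 2 * π * -(v * (b / π * M)) = -(2 * M * (b * v)) := by field_simp
    rw [hψ, Set.indicator_of_mem hv, Set.indicator_of_mem hv, Circle.smul_def,
      Real.fourierChar_apply, smul_eq_mul, RCLike.re_to_complex, Complex.re_mul_ofReal,
      harg, Complex.exp_ofReal_mul_I_re, Real.cos_neg, mul_comm]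
  · simp [hψ, hv]

theorem sin_mul_sum_two_mul_sin (θ : ℝ) (M : ℕ) :
    Real.sin θ * ∑ n ∈ Finset.range M, 2 * Real.sin ((2 * n + 1) * θ) =
      1 - Real.cos (2 * M * θ) := by
  induction M with
  | zero => simp
  | succ M ih =>
    rw [Finset.sum_range_succ, mul_add, ih]
    have h := Real.cos_sub_cos (2 * M * θ) (2 * (M + 1 : ℕ) * θ)
    rw [show (2 * M * θ + 2 * (M + 1 : ℕ) * θ) / 2 = (2 * M + 1) * θ by push_cast; ring,
      show (2 * M * θ - 2 * (M + 1 : ℕ) * θ) / 2 = -θ by push_cast; ring, Real.sin_neg] at h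
    linarith

/-- `sinQuotient` multiplied by the factor `1 - cos (2 M b t)`, which removes its poles. -/
noncomputable def desingularized (a b x : ℝ) (M : ℕ) (t : ℝ) : ℝ :=
  Real.sin (a * t) * (∑ n ∈ Finset.range M, 2 * Real.sin ((2 * n + 1) * (b * t))) *
    (x ^ 2 + t ^ 2)⁻¹

theorem continuous_desingularized {a b x : ℝ} (hx : 0 < x) (M : ℕ) :
    Continuous (desingularized a b x M) := by
  have h (t : ℝ) : x ^ 2 + t ^ 2 ≠ 0 := by positivity
  unfold desingularized
  fun_prop (disch := exact h)

theorem sinQuotient_mul_eq_desingularized {a b x t : ℝ} (M : ℕ) (ht : Real.sin (b * t) ≠ 0) :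
    sinQuotient a b x t * (1 - Real.cos (2 * M * (b * t))) = desingularized a b x M t := by
  rw [← sin_mul_sum_two_mul_sin, sinQuotient, desingularized, div_mul_eq_mul_div,
    ← mul_assoc, mul_right_comm, mul_comm (Real.sin (b * t)) (x ^ 2 + t ^ 2),
    mul_div_mul_right _ _ ht, div_eq_mul_inv]

theorem desingularized_eq_sum (a b x : ℝ) (M : ℕ) (t : ℝ) :
    desingularized a b x M t = ∑ n ∈ Finset.range M,
      (Real.cos (((2 * n + 1) * b - a) * t) * (x ^ 2 + t ^ 2)⁻¹ -
        Real.cos (((2 * n + 1) * b + a) * t) * (x ^ 2 + t ^ 2)⁻¹) := by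
  rw [desingularized, Finset.mul_sum, Finset.sum_mul]
  refine Finset.sum_congr rfl fun n _ => ?_
  rw [sub_mul _ a t, add_mul _ a t, Real.cos_sub, Real.cos_add, mul_assoc (2 * (n : ℝ) + 1) b t]
  ring

theorem integrableOn_cos_mul_inv_sq_add_sq {x : ℝ} (hx : 0 < x) (c : ℝ) :
    IntegrableOn (fun t : ℝ => Real.cos (c * t) * (x ^ 2 + t ^ 2)⁻¹) (Set.Ioi 0) := by
  refine ((integrable_inv_sq_add_sq hx).bdd_mul (c := 1) ?_ ?_).integrableOn
  · exact Continuous.aestronglyMeasurable (by fun_prop)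
  · exact ae_of_all _ fun t => Real.abs_cos_le_one _

theorem integrableOn_desingularized {a b x : ℝ} (hx : 0 < x) (M : ℕ) :
    IntegrableOn (desingularized a b x M) (Set.Ioi 0) := by
  rw [funext (desingularized_eq_sum a b x M)]
  exact integrable_finsetSum _ fun n _ => (integrableOn_cos_mul_inv_sq_add_sq hx _).sub
    (integrableOn_cos_mul_inv_sq_add_sq hx _)

theorem integral_desingularized {a b x : ℝ} (ha : 0 < a) (hab : a < b) (hx : 0 < x) (M : ℕ) :
    ∫ t in Set.Ioi (0 : ℝ), desingularized a b x M t =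
      ∑ n ∈ Finset.range M,
        π / x * Real.sinh (a * x) * Real.exp (-(b * x)) * Real.exp (-(2 * (b * x))) ^ n := by
  simp_rw [desingularized_eq_sum]
  rw [MeasureTheory.integral_finsetSum]
  swap
  · exact fun n _ => (integrableOn_cos_mul_inv_sq_add_sq hx _).sub
      (integrableOn_cos_mul_inv_sq_add_sq hx _)
  refine Finset.sum_congr rfl fun n _ => ?_
  have hnb : 0 ≤ 2 * n * b := by have := ha.trans hab; positivity
  rw [MeasureTheory.integral_sub (integrableOn_cos_mul_inv_sq_add_sq hx _)
      (integrableOn_cos_mul_inv_sq_add_sq hx _),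
    integral_cos_mul_inv_sq_add_sq hx (by linarith), integral_cos_mul_inv_sq_add_sq hx (by linarith),
    Real.sinh_eq, ← Real.exp_nat_mul,
    show -(((2 * n + 1) * b - a) * x) = a * x + -(b * x) + n * -(2 * (b * x)) by ring,
    show -(((2 * n + 1) * b + a) * x) = -(a * x) + -(b * x) + n * -(2 * (b * x)) by ring]
  simp only [Real.exp_add]
  ring

theorem tendsto_integral_desingularized {a b x : ℝ} (ha : 0 < a) (hab : a < b) (hx : 0 < x) :
    Tendsto (fun M : ℕ => ∫ t in Set.Ioi (0 : ℝ), desingularized a b x M t) atTop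
      (nhds (π / 2 * Real.sinh (a * x) / (x * Real.sinh (b * x)))) := by
  have hbx : 0 < b * x := mul_pos (ha.trans hab) hx
  simp_rw [integral_desingularized ha hab hx]
  have hlt : Real.exp (-(2 * (b * x))) < 1 := Real.exp_lt_one_iff.2 (by linarith)
  have h := ((hasSum_geometric_of_lt_one (Real.exp_pos _).le hlt).mul_left
    (π / x * Real.sinh (a * x) * Real.exp (-(b * x)))).tendsto_sum_nat
  convert h using 2
  have hden : Real.exp (-(b * x)) * (1 - Real.exp (-(2 * (b * x))))⁻¹ =
      1 / (2 * Real.sinh (b * x)) := by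
    have e : Real.exp (-(2 * (b * x))) = Real.exp (-(b * x)) * Real.exp (-(b * x)) := by
      rw [← Real.exp_add]; ring_nf
    have e' : Real.exp (b * x) * Real.exp (-(b * x)) = 1 := by
      rw [← Real.exp_add, add_neg_cancel, Real.exp_zero]
    have hs : 0 < Real.sinh (b * x) := Real.sinh_pos_iff.2 hbx
    rw [← div_eq_mul_inv, div_eq_div_iff (by linarith) (by positivity), e, Real.sinh_eq]
    linear_combination e'
  rw [mul_assoc (π / x * _), hden]
  field_simp

theorem abs_integral_sinQuotientFold_mul_le {a b x : ℝ} (ha : 0 < a) (hb : 0 < b) (hx : 0 < x)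
    (k : ℕ) {ε : ℝ} (hε : ε ∈ Set.Ico 0 (π / (2 * b))) {w : ℝ → ℝ} (hw : ∀ s, |w s| ≤ 1) :
    ‖∫ s in ε..(π / (2 * b)), sinQuotientFold a b x k s * w s‖ ≤
      π / (2 * b) * foldBound a b x k := by
  have h0 : 0 ≤ foldBound a b x k := (abs_nonneg _).trans
    (abs_sinQuotientFold_le ha hb hx k (s := π / (2 * b)) ⟨by positivity, le_rfl⟩)
  have h := norm_integral_le_of_norm_le_const (a := ε) (b := π / (2 * b))
    (f := fun s => sinQuotientFold a b x k s * w s) (C := foldBound a b x k) fun s hs => by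
      rw [Set.uIoc_of_le hε.2.le] at hs
      rw [Real.norm_eq_abs, abs_mul]
      exact (mul_le_of_le_one_right (abs_nonneg _) (hw s)).trans
        (abs_sinQuotientFold_le ha hb hx k ⟨hε.1.trans_lt hs.1, hs.2⟩)
  rw [abs_of_pos (sub_pos.2 hε.2)] at h
  nlinarith [hε.1]

theorem abs_integral_sinQuotientFold_le {a b x : ℝ} (ha : 0 < a) (hb : 0 < b) (hx : 0 < x)
    (k : ℕ) {ε : ℝ} (hε : ε ∈ Set.Ico 0 (π / (2 * b))) :
    ‖∫ s in ε..(π / (2 * b)), sinQuotientFold a b x k s‖ ≤ π / (2 * b) * foldBound a b x k := by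
  simpa using abs_integral_sinQuotientFold_mul_le ha hb hx k hε (w := fun _ => 1) (by simp)

theorem integral_sub_integral_mul_cos {φ Ψ : ℝ → ℝ} {b h : ℝ} {M : ℕ} (hh : 0 ≤ h)
    (hφ : IntervalIntegrable φ volume 0 h)
    (hΨ : ∀ s ∈ Set.Ioc 0 h, φ s * (1 - Real.cos (2 * M * (b * s))) = Ψ s) :
    (∫ s in (0 : ℝ)..h, φ s) - ∫ s in (0 : ℝ)..h, φ s * Real.cos (2 * M * (b * s)) =
      ∫ s in (0 : ℝ)..h, Ψ s := by
  rw [← integral_sub hφ (hφ.mul_continuousOn (by fun_prop))]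
  refine integral_congr_ae (ae_of_all _ fun s hs => ?_)
  rw [Set.uIoc_of_le hh] at hs
  rw [← hΨ s hs]
  ring

theorem sinQuotientFold_mul_eq_desingularized {a b x s : ℝ} (hb : 0 < b) (M k : ℕ)
    (hs : s ∈ Set.Ioc 0 (π / (2 * b))) :
    sinQuotientFold a b x k s * (1 - Real.cos (2 * M * (b * s))) =
      desingularized a b x M (sinPole b k + s) + desingularized a b x M (sinPole b k - s) := by
  have hsin := (sin_mul_pos hb hs).ne'
  rw [← sinQuotient_mul_eq_desingularized, ← sinQuotient_mul_eq_desingularized,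
    cos_mul_sinPole_add hb, cos_mul_sinPole_sub hb, sinQuotientFold, add_mul]
  · rw [sin_mul_sinPole_sub hb]; simpa using hsin
  · rw [sin_mul_sinPole_add hb]; simpa using hsin

theorem integral_add_tsum_fold_sub_eq {a b x : ℝ} (ha : 0 < a) (hb : 0 < b) (hx : 0 < x) (M : ℕ) :
    ((∫ t in (0 : ℝ)..(π / (2 * b)), sinQuotient a b x t) +
        ∑' k, ∫ s in (0 : ℝ)..(π / (2 * b)), sinQuotientFold a b x k s) -
      ((∫ t in (0 : ℝ)..(π / (2 * b)), sinQuotient a b x t * Real.cos (2 * M * (b * t))) +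
        ∑' k, ∫ s in (0 : ℝ)..(π / (2 * b)),
          sinQuotientFold a b x k s * Real.cos (2 * M * (b * s))) =
      ∫ t in Set.Ioi (0 : ℝ), desingularized a b x M t := by
  have hh : 0 < π / (2 * b) := by positivity
  have hu := (summable_foldBound a b x).mul_left (π / (2 * b))
  have hs₁ := Summable.of_norm_bounded hu fun k =>
    abs_integral_sinQuotientFold_le ha hb hx k (ε := 0) ⟨le_rfl, hh⟩
  have hs₂ := Summable.of_norm_bounded hu fun k =>
    abs_integral_sinQuotientFold_mul_le ha hb hx k (ε := 0) ⟨le_rfl, hh⟩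
      (w := fun s => Real.cos (2 * M * (b * s))) fun s => Real.abs_cos_le_one _
  have h₁ := (hs₁.hasSum.sub hs₂.hasSum).tendsto_sum_nat.const_add
    (∫ t in (0 : ℝ)..(π / (2 * b)), desingularized a b x M t)
  have hgrow : Tendsto (fun N : ℕ => (2 * (N : ℝ) + 1) * (π / (2 * b))) atTop atTop :=
    ((tendsto_natCast_atTop_atTop.const_mul_atTop two_pos).atTop_add
      tendsto_const_nhds).atTop_mul_const hh
  have h₂ := intervalIntegral_tendsto_integral_Ioi 0
    (integrableOn_desingularized (a := a) (b := b) hx M) hgrow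
  have h₃ := tendsto_nhds_unique h₂ (h₁.congr fun N => by
    rw [← integral_fold_eq (continuous_desingularized hx M)]
    congr 1
    exact Finset.sum_congr rfl fun k _ => integral_sub_integral_mul_cos hh.le
      (intervalIntegrable_sinQuotientFold ha hb hx k)
      fun s hs => sinQuotientFold_mul_eq_desingularized hb M k hs)
  have h₄ := integral_sub_integral_mul_cos (M := M) hh.le
    (intervalIntegrable_sinQuotient ha hb hx)
    fun s hs => sinQuotient_mul_eq_desingularized M (sin_mul_pos hb hs).ne'
  linarith

theorem integral_add_tsum_fold_eq {a b x : ℝ} (ha : 0 < a) (hab : a < b) (hx : 0 < x) :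
    (∫ t in (0 : ℝ)..(π / (2 * b)), sinQuotient a b x t) +
        ∑' k, ∫ s in (0 : ℝ)..(π / (2 * b)), sinQuotientFold a b x k s =
      π / 2 * Real.sinh (a * x) / (x * Real.sinh (b * x)) := by
  have hb := ha.trans hab
  have hh : 0 < π / (2 * b) := by positivity
  have h₁ := tendsto_integral_mul_cos hb hh.le (intervalIntegrable_sinQuotient ha hb hx)
  have h₂ : Tendsto (fun M : ℕ => ∑' k, ∫ s in (0 : ℝ)..(π / (2 * b)),
      sinQuotientFold a b x k s * Real.cos (2 * M * (b * s))) atTop (nhds (∑' _ : ℕ, 0)) :=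
    tendsto_tsum_of_dominated_convergence ((summable_foldBound a b x).mul_left (π / (2 * b)))
      (fun k => tendsto_integral_mul_cos hb hh.le (intervalIntegrable_sinQuotientFold ha hb hx k))
      (Eventually.of_forall fun M k => abs_integral_sinQuotientFold_mul_le ha hb hx k
        ⟨le_rfl, hh⟩ fun s => Real.abs_cos_le_one _)
  have h₃ := (h₁.add h₂).const_sub ((∫ t in (0 : ℝ)..(π / (2 * b)), sinQuotient a b x t) +
        ∑' k, ∫ s in (0 : ℝ)..(π / (2 * b)), sinQuotientFold a b x k s)
  simp_rw [integral_add_tsum_fold_sub_eq ha hb hx, tsum_zero, add_zero, sub_zero] at h₃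
  exact tendsto_nhds_unique h₃ (tendsto_integral_desingularized ha hab hx)

theorem tendsto_integral_sinQuotient_sinPole_sub {a b x ε : ℝ} (hb : 0 < b)
    (hε : ε ∈ Set.Ioo 0 (π / (2 * b))) :
    Tendsto (fun N => ∫ s in ε..(π / (2 * b)), sinQuotient a b x (sinPole b N - s)) atTop
      (nhds 0) := by
  have hε0 := hε.1
  have hh : 0 < π / (2 * b) := by positivity
  have hden : Tendsto (fun N : ℕ => 2 / π * (b * ε) * (π / (2 * b) * (N + 1)) ^ 2) atTop atTop :=
    ((tendsto_pow_atTop two_ne_zero).comp ((tendsto_natCast_atTop_atTop.atTop_add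
      tendsto_const_nhds).const_mul_atTop hh)).const_mul_atTop (by positivity)
  have hlim := (hden.inv_tendsto_atTop).mul_const |π / (2 * b) - ε|
  rw [zero_mul] at hlim
  refine squeeze_zero_norm (fun N => norm_integral_le_of_norm_le_const fun s hs => ?_) hlim
  rw [Set.uIoc_of_le hε.2.le] at hs
  rw [Pi.inv_apply, ← one_div]
  exact abs_sinQuotient_sinPole_sub_le hb N hε0 ⟨hs.1.le, hs.2⟩

theorem tendsto_tsum_integral_sinQuotientFold {a b x : ℝ} (ha : 0 < a) (hb : 0 < b)
    (hx : 0 < x) :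
    Tendsto (fun ε => ∑' k, ∫ s in ε..(π / (2 * b)), sinQuotientFold a b x k s)
      (nhdsWithin 0 (Set.Ioi 0))
      (nhds (∑' k, ∫ s in (0 : ℝ)..(π / (2 * b)), sinQuotientFold a b x k s)) := by
  have hh : 0 < π / (2 * b) := by positivity
  refine tendsto_tsum_of_dominated_convergence
    ((summable_foldBound a b x).mul_left (π / (2 * b))) (fun k => ?_) ?_
  · have hint : IntegrableOn (sinQuotientFold a b x k) (Set.uIcc 0 (π / (2 * b))) := by
      rw [Set.uIcc_of_le hh.le, integrableOn_Icc_iff_integrableOn_Ioc]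
      exact (intervalIntegrable_iff_integrableOn_Ioc_of_le hh.le).1
        (intervalIntegrable_sinQuotientFold ha hb hx k)
    refine (continuousOn_primitive_interval_left hint 0 Set.left_mem_uIcc).tendsto.mono_left ?_
    rw [Set.uIcc_of_le hh.le, nhdsWithin_Icc_eq_nhdsGE hh]
    exact nhdsWithin_mono _ Set.Ioi_subset_Ici_self
  · filter_upwards [Ioo_mem_nhdsGT hh] with ε hε k
    exact abs_integral_sinQuotientFold_le ha hb hx k ⟨hε.1.le, hε.2⟩

theorem pv_sin_over_sin (a b x : ℝ) (hx : 0 < x) (ha : 0 < a) (hab : a < b) :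
    IsPVIntegral (fun t => Real.sin (a * t) / (Real.sin (b * t) * (x ^ 2 + t ^ 2))) (fun k => ((k : ℝ) + 1) * Real.pi / b) ((Real.pi / 2) * Real.sinh (a * x) / (x * Real.sinh (b * x))) := by
  have hb := ha.trans hab
  change IsPVIntegral (sinQuotient a b x) (sinPole b) _
  rw [← integral_add_tsum_fold_eq ha hab hx]
  refine ⟨π / (2 * b), by positivity,
    fun ε => (∫ t in (0 : ℝ)..(π / (2 * b)), sinQuotient a b x t) +
      ∑' k, ∫ s in ε..(π / (2 * b)), sinQuotientFold a b x k s, fun ε hε => ?_,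
    (tendsto_tsum_integral_sinQuotientFold ha hb hx).const_add _⟩
  simp_rw [integral_gap_sum_eq_fold ha hb hx hε]
  have hsum := Summable.of_norm_bounded ((summable_foldBound a b x).mul_left (π / (2 * b)))
    fun k => abs_integral_sinQuotientFold_le ha hb hx k ⟨hε.1.le, hε.2⟩
  simpa using (hsum.hasSum.tendsto_sum_nat.const_add _).add
    (tendsto_integral_sinQuotient_sinPole_sub hb hε)
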